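/- Let α ∈ ℝ[t] be nonzero, let A ∈ ℍ[t] be nonzero and reduced with respect to i, and write A i Ā = F₁·i + F₂·j + F₃·k with F₁, F₂, F₃ ∈ ℝ[t]. Let z ∈ ℂ be a root of α (viewed in ℂ[t]) of multiplicity exactly 2. Then the following are equivalent: (a) there exist μ ∈ ℂ[t] and b₁, b₂, b₃ ∈ ℂ[t], not all divisible by (X − z)², such that α·b_m′ − α′·b_m = μ·F_m for m = 1, 2, 3 (all polynomials viewed in ℂ[t]); (b) the three vectors (F₁(z), F₂(z), F₃(z)), (F₁′(z), F₂′(z), F₃′(z)) and (F₁″(z), F₂″(z), F₃″(z)) of ℂ³ are linearly dependent over ℂ. -/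

import Mathlib

open Polynomial

noncomputable section

/-- The quaternion unit `i`. -/
def qi : Quaternion ℝ := ⟨0, 1, 0, 0⟩
/-- The quaternion unit `j`. -/
def qj : Quaternion ℝ := ⟨0, 0, 1, 0⟩
/-- The quaternion unit `k`. -/
def qk : Quaternion ℝ := ⟨0, 0, 0, 1⟩

/-- Embedding of real polynomials into quaternion polynomials (scalar coefficients). -/
def toQ : Polynomial ℝ →+* Polynomial (Quaternion ℝ) :=
  mapRingHom (algebraMap ℝ (Quaternion ℝ))

/-- Embedding of real polynomials into complex polynomials. -/
def toC : Polynomial ℝ →+* Polynomial ℂ :=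
  mapRingHom (algebraMap ℝ ℂ)

/-- Coefficientwise quaternion conjugation of a quaternion polynomial. -/
def pconj (p : Polynomial (Quaternion ℝ)) : Polynomial (Quaternion ℝ) :=
  p.sum fun n a => monomial n (star a)

/-- `A ∈ ℍ[t]` is *reduced with respect to `i`* if it has no real polynomial factor of
positive degree and no right factor of positive degree all of whose coefficients lie in the
subalgebra of `ℍ` generated by `1` and `i`. -/
def ReducedWrtI (A : Polynomial (Quaternion ℝ)) : Prop :=
  (∀ ψ : Polynomial ℝ, ∀ A' : Polynomial (Quaternion ℝ), A = toQ ψ * A' → ψ.natDegree = 0) ∧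
  (∀ A' R : Polynomial (Quaternion ℝ), A = A' * R →
    (∀ n, (R.coeff n).imJ = 0 ∧ (R.coeff n).imK = 0) → R.natDegree = 0)

@[simp] theorem re_qi : qi.re = 0 := rfl
@[simp] theorem imI_qi : qi.imI = 1 := rfl
@[simp] theorem imJ_qi : qi.imJ = 0 := rfl
@[simp] theorem imK_qi : qi.imK = 0 := rfl
@[simp] theorem re_qj : qj.re = 0 := rfl
@[simp] theorem imI_qj : qj.imI = 0 := rfl
@[simp] theorem imJ_qj : qj.imJ = 1 := rfl
@[simp] theorem imK_qj : qj.imK = 0 := rfl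
@[simp] theorem re_qk : qk.re = 0 := rfl
@[simp] theorem imI_qk : qk.imI = 0 := rfl
@[simp] theorem imJ_qk : qk.imJ = 0 := rfl
@[simp] theorem imK_qk : qk.imK = 1 := rfl

theorem eval_coe_real_mul (t : ℝ) (A B : Polynomial (Quaternion ℝ)) :
    (A * B).eval (t : Quaternion ℝ) = A.eval (t : Quaternion ℝ) * B.eval (t : Quaternion ℝ) :=
  eval₂_mul_noncomm _ _ fun n => Quaternion.coe_commutes t (B.coeff n) |>.symm

theorem pconj_add (A B : Polynomial (Quaternion ℝ)) : pconj (A + B) = pconj A + pconj B :=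
  sum_add_index _ _ _ (by simp) (by simp)

theorem eval_coe_real_pconj (t : ℝ) (A : Polynomial (Quaternion ℝ)) :
    (pconj A).eval (t : Quaternion ℝ) = star (A.eval (t : Quaternion ℝ)) := by
  induction A using Polynomial.induction_on' with
  | add p q hp hq => simp [pconj_add, hp, hq]
  | monomial n a =>
    rw [pconj, sum_monomial_index _ _ (by simp)]
    simp only [eval_monomial, star_mul, star_pow, Quaternion.star_coe]
    rw [← Quaternion.coe_pow, Quaternion.coe_commutes]

theorem eval_coe_real_toQ (t : ℝ) (p : Polynomial ℝ) :
    (toQ p).eval (t : Quaternion ℝ) = ((p.eval t : ℝ) : Quaternion ℝ) :=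
  eval_map_apply (p := p) (algebraMap ℝ (Quaternion ℝ)) t

theorem eval_ofReal_toC (t : ℝ) (p : Polynomial ℝ) :
    (toC p).eval (t : ℂ) = ((p.eval t : ℝ) : ℂ) :=
  eval_map_apply (p := p) (algebraMap ℝ ℂ) t

/-- The embedding of `ℂ[t]` into `ℍ[t]` sending the imaginary unit to `i`. -/
def complexToQ : Polynomial ℂ →+* Polynomial (Quaternion ℝ) :=
  mapRingHom (Quaternion.ofComplex : ℂ →ₐ[ℝ] Quaternion ℝ).toRingHom

theorem exists_eq_complexToQ_add (A : Polynomial (Quaternion ℝ)) :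
    ∃ p q : Polynomial ℂ, A = complexToQ p + Polynomial.C qj * complexToQ q := by
  induction A using Polynomial.induction_on' with
  | add A B hA hB =>
    obtain ⟨p, q, rfl⟩ := hA
    obtain ⟨p', q', rfl⟩ := hB
    exact ⟨p + p', q + q', by simp only [map_add, mul_add]; abel⟩
  | monomial n a =>
    refine ⟨monomial n ⟨a.re, a.imI⟩, monomial n ⟨a.imJ, -a.imK⟩, ?_⟩
    simp only [complexToQ, coe_mapRingHom, map_monomial, C_mul_monomial, ← map_add]
    congr 1
    ext <;> simp

theorem eval_coe_real_complexToQ (t : ℝ) (p : Polynomial ℂ) :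
    (complexToQ p).eval (t : Quaternion ℝ) = ((p.eval (t : ℂ) : ℂ) : Quaternion ℝ) := by
  have := eval_map_apply (p := p) (Quaternion.ofComplex : ℂ →ₐ[ℝ] Quaternion ℝ).toRingHom (t : ℂ)
  simpa [complexToQ] using this

theorem eval_map_conj (p : Polynomial ℂ) (z : ℂ) :
    (p.map (starRingEnd ℂ)).eval z = starRingEnd ℂ (p.eval (starRingEnd ℂ z)) := by
  have := eval_map_apply (p := p) (starRingEnd ℂ) (starRingEnd ℂ z)
  simpa using this

theorem eq_of_eval_ofReal_eq {p q : Polynomial ℂ} (h : ∀ t : ℝ, p.eval (t : ℂ) = q.eval (t : ℂ)) :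
    p = q :=
  eq_of_infinite_eval_eq p q <|
    (Set.infinite_range_of_injective Complex.ofReal_injective).mono (by rintro _ ⟨t, rfl⟩; exact h t)

/-- If the two complex components of a quaternion polynomial have a common root, then the
polynomial is not reduced. -/
theorem ReducedWrtI.not_common_root {p q : Polynomial ℂ}
    (h : ReducedWrtI (complexToQ p + Polynomial.C qj * complexToQ q)) {w : ℂ}
    (hp : p.eval w = 0) (hq : q.eval w = 0) : False := by
  obtain ⟨p', rfl⟩ := dvd_iff_isRoot.mpr hp
  obtain ⟨q', rfl⟩ := dvd_iff_isRoot.mpr hq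
  have hR : complexToQ (X - Polynomial.C w) = X - Polynomial.C (w : Quaternion ℝ) := by
    simp [complexToQ]
  have := h.2 (complexToQ p' + Polynomial.C qj * complexToQ q') (complexToQ (X - Polynomial.C w))
    (by rw [mul_comm _ p', mul_comm _ q', map_mul, map_mul, add_mul, mul_assoc]) (by
      intro n
      rw [complexToQ, coe_mapRingHom, coeff_map]
      exact ⟨Quaternion.imJ_coeComplex _, Quaternion.imK_coeComplex _⟩)
  rw [hR, natDegree_X_sub_C] at this
  exact one_ne_zero this

theorem ReducedWrtI.eval_ne_zero {A : Polynomial (Quaternion ℝ)} (hred : ReducedWrtI A)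
    {F₁ F₂ F₃ : Polynomial ℝ}
    (hF : A * Polynomial.C qi * pconj A
      = toQ F₁ * Polynomial.C qi + toQ F₂ * Polynomial.C qj + toQ F₃ * Polynomial.C qk) (z : ℂ) :
    ¬((toC F₁).eval z = 0 ∧ (toC F₂).eval z = 0 ∧ (toC F₃).eval z = 0) := by
  rintro ⟨h₁, h₂, h₃⟩
  obtain ⟨p, q, rfl⟩ := exists_eq_complexToQ_add A
  have key (t : ℝ) := congrArg (eval (t : Quaternion ℝ)) hF
  simp only [eval_coe_real_mul, eval_add, eval_coe_real_pconj, eval_coe_real_toQ,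
    eval_coe_real_complexToQ, eval_C] at key
  have keyI (t : ℝ) := congrArg (fun a : Quaternion ℝ => a.imI) (key t)
  have keyJ (t : ℝ) := congrArg (fun a : Quaternion ℝ => a.imJ) (key t)
  have keyK (t : ℝ) := congrArg (fun a : Quaternion ℝ => a.imK) (key t)
  simp at keyI keyJ keyK
  have e₁ : toC F₁ = p * p.map (starRingEnd ℂ) - q * q.map (starRingEnd ℂ) := by
    refine eq_of_eval_ofReal_eq fun t => ?_
    simp only [eval_ofReal_toC, eval_sub, eval_mul, eval_map_conj, Complex.conj_ofReal, ← keyI]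
    apply Complex.ext <;> simp <;> ring
  have e₂ : toC F₂ + Polynomial.C Complex.I * toC F₃
      = Polynomial.C (-2 * Complex.I) * (p * q.map (starRingEnd ℂ)) := by
    refine eq_of_eval_ofReal_eq fun t => ?_
    simp only [eval_ofReal_toC, eval_add, eval_mul, eval_map_conj, Complex.conj_ofReal, ← keyJ,
      ← keyK, eval_C]
    apply Complex.ext <;> simp <;> ring
  have e₃ : toC F₂ - Polynomial.C Complex.I * toC F₃
      = Polynomial.C (2 * Complex.I) * (p.map (starRingEnd ℂ) * q) := by
    refine eq_of_eval_ofReal_eq fun t => ?_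
    simp only [eval_ofReal_toC, eval_sub, eval_mul, eval_map_conj, Complex.conj_ofReal, ← keyJ,
      ← keyK, eval_C]
    apply Complex.ext <;> simp <;> ring
  have f₁ := congrArg (eval z) e₁
  have f₂ := congrArg (eval z) e₂
  have f₃ := congrArg (eval z) e₃
  simp only [eval_add, eval_sub, eval_mul, eval_C, eval_map_conj, h₁, h₂, h₃] at f₁ f₂ f₃
  have hI := Complex.I_ne_zero
  simp [hI] at f₂ f₃
  rcases f₂ with hp | hq
  · rcases f₃ with hp' | hq
    · simp [hp] at f₁
      rcases f₁ with hq | hq'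
      · exact hred.not_common_root hp hq
      · exact hred.not_common_root hp' hq'
    · exact hred.not_common_root hp hq
  · rcases f₃ with hp' | hq'
    · exact hred.not_common_root hp' hq
    · simp [hq'] at f₁
      rcases f₁ with hp | hp'
      · exact hred.not_common_root hp hq'
      · exact hred.not_common_root hp' hq

/-- A polynomial is divisible by `(X - z)²` iff it and its derivative vanish at `z`. -/
theorem X_sub_C_sq_dvd_iff (z : ℂ) (b : Polynomial ℂ) :
    (X - Polynomial.C z) ^ 2 ∣ b ↔ b.eval z = 0 ∧ (derivative b).eval z = 0 := by
  constructor
  · rintro ⟨c, rfl⟩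
    simp [derivative_pow]
  · rintro ⟨h₀, h₁⟩
    obtain ⟨c, rfl⟩ := dvd_iff_isRoot.mpr h₀
    have hc : c.eval z = 0 := by simpa using h₁
    obtain ⟨d, rfl⟩ := dvd_iff_isRoot.mpr hc
    exact ⟨d, by ring⟩

theorem exists_X_mul_derivative_sub_eq (P : Polynomial ℂ) (hP : P.coeff 2 = 0) :
    ∃ c : Polynomial ℂ, X * derivative c - 2 * c = P := by
  refine ⟨P.sum fun n a => monomial n (a / ((n : ℂ) - 2)), ?_⟩
  have hc (n : ℕ) : (P.sum fun n a => monomial n (a / ((n : ℂ) - 2))).coeff n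
      = P.coeff n / ((n : ℂ) - 2) := by
    rw [sum_def, finsetSum_coeff]
    simp only [coeff_monomial]
    rw [Finset.sum_ite_eq' P.support n]
    split_ifs with h
    · rfl
    · simp [notMem_support_iff.mp h]
  ext n
  have h2 : (2 : Polynomial ℂ) = Polynomial.C 2 := rfl
  rw [coeff_sub, h2, coeff_C_mul, hc]
  rcases eq_or_ne n 2 with rfl | hn
  · simp [coeff_derivative, coeff_X_mul, hc, hP]
  have hn' : (n : ℂ) - 2 ≠ 0 := sub_ne_zero.mpr (by exact_mod_cast hn)
  cases n with
  | zero =>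
    simp
    ring
  | succ m =>
    rw [coeff_X_mul, coeff_derivative, hc]
    push_cast at hn' ⊢
    field_simp

theorem exists_X_sub_C_mul_derivative_sub_eq (z : ℂ) (P : Polynomial ℂ)
    (hP : (derivative (derivative P)).eval z = 0) :
    ∃ c : Polynomial ℂ, (X - Polynomial.C z) * derivative c - 2 * c = P := by
  obtain ⟨c, hc⟩ := exists_X_mul_derivative_sub_eq (P.comp (X + Polynomial.C z)) (by
    have h : (2 : ℂ) * (P.comp (X + Polynomial.C z)).coeff 2
        = (derivative (derivative (P.comp (X + Polynomial.C z)))).coeff 0 := by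
      simp only [coeff_derivative]; push_cast; ring
    rw [coeff_zero_eq_eval_zero] at h
    simpa [derivative_comp, eval_comp, hP] using h)
  refine ⟨c.comp (X - Polynomial.C z), ?_⟩
  have := congrArg (fun Q => Q.comp (X - Polynomial.C z)) hc
  simpa [comp_assoc, derivative_comp] using this

/-- Evaluations at `z` of `ν F = (X - z) (β b' - β' b) - 2 β b` and its first two derivatives. -/
theorem eval_derivatives_of_eq {z : ℂ} {β b ν F : Polynomial ℂ}
    (h : (X - Polynomial.C z) * (β * derivative b - derivative β * b) - 2 * (β * b) = ν * F) :
    -2 * (β.eval z * b.eval z) = ν.eval z * F.eval z ∧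
    -(β.eval z * (derivative b).eval z) - 3 * ((derivative β).eval z * b.eval z)
      = (derivative ν).eval z * F.eval z + ν.eval z * (derivative F).eval z ∧
    -4 * ((derivative (derivative β)).eval z * b.eval z
        + (derivative β).eval z * (derivative b).eval z)
      = (derivative (derivative ν)).eval z * F.eval z
        + 2 * ((derivative ν).eval z * (derivative F).eval z)
        + ν.eval z * (derivative (derivative F)).eval z := by
  have h' := congrArg derivative h
  have h'' := congrArg derivative h'
  replace h := congrArg (eval z) h
  replace h' := congrArg (eval z) h'
  replace h'' := congrArg (eval z) h''
  simp at h h' h''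
  refine ⟨?_, ?_, ?_⟩
  · linear_combination h
  · linear_combination h'
  · linear_combination h''

/-- Let `z ∈ ℂ` be a root of `α` of multiplicity exactly `2` and write
`A i Ā = F₁·i + F₂·j + F₃·k`.  There exist `μ, b₁, b₂, b₃ ∈ ℂ[t]`, not all `b_m` divisible
by `(X − z)²`, with `α·b_m′ − α′·b_m = μ·F_m` for `m = 1, 2, 3`, if and only if the vectors
`(F₁(z), F₂(z), F₃(z))`, `(F₁′(z), F₂′(z), F₃′(z))` and `(F₁″(z), F₂″(z), F₃″(z))` of `ℂ³`
are linearly dependent. -/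
theorem rational_solution_iff_multiplicity_two (α : Polynomial ℝ) (hα : α ≠ 0)
    (A : Polynomial (Quaternion ℝ)) (hA : A ≠ 0) (hred : ReducedWrtI A)
    (F₁ F₂ F₃ : Polynomial ℝ)
    (hF : A * Polynomial.C qi * pconj A
      = toQ F₁ * Polynomial.C qi + toQ F₂ * Polynomial.C qj + toQ F₃ * Polynomial.C qk)
    (z : ℂ) (hz : rootMultiplicity z (toC α) = 2) :
    (∃ μ b₁ b₂ b₃ : Polynomial ℂ,
      ¬(((X - Polynomial.C z) ^ 2 ∣ b₁) ∧ ((X - Polynomial.C z) ^ 2 ∣ b₂) ∧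
        ((X - Polynomial.C z) ^ 2 ∣ b₃)) ∧
      toC α * derivative b₁ - derivative (toC α) * b₁ = μ * toC F₁ ∧
      toC α * derivative b₂ - derivative (toC α) * b₂ = μ * toC F₂ ∧
      toC α * derivative b₃ - derivative (toC α) * b₃ = μ * toC F₃) ↔
    ¬LinearIndependent ℂ
      ![![(toC F₁).eval z, (toC F₂).eval z, (toC F₃).eval z],
        ![(derivative (toC F₁)).eval z, (derivative (toC F₂)).eval z,
          (derivative (toC F₃)).eval z],
        ![(derivative (derivative (toC F₁))).eval z, (derivative (derivative (toC F₂))).eval z,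
          (derivative (derivative (toC F₃))).eval z]] := by
  have hne := hred.eval_ne_zero hF z
  generalize toC F₁ = f₁ at *
  generalize toC F₂ = f₂ at *
  generalize toC F₃ = f₃ at *
  have hα' : toC α ≠ 0 := fun h => by simp [h] at hz
  obtain ⟨β, hβ, hβz⟩ := exists_eq_pow_rootMultiplicity_mul_and_not_dvd (toC α) hα' z
  rw [hz] at hβ
  have hβ0 : β.eval z ≠ 0 := fun h => hβz (dvd_iff_isRoot.mpr h)
  generalize toC α = a at *
  subst hβ
  have hX : (X - Polynomial.C z : Polynomial ℂ) ≠ 0 := X_sub_C_ne_zero z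
  have hW (b : Polynomial ℂ) : (X - Polynomial.C z) ^ 2 * β * derivative b
      - derivative ((X - Polynomial.C z) ^ 2 * β) * b
      = (X - Polynomial.C z) * ((X - Polynomial.C z) * (β * derivative b - derivative β * b)
        - 2 * (β * b)) := by
    have h2 : (2 : Polynomial ℂ) = Polynomial.C 2 := rfl
    simp [derivative_pow, h2]
    ring
  rw [Fintype.not_linearIndependent_iff]
  constructor
  · rintro ⟨μ, b₁, b₂, b₃, hb, hb₁, hb₂, hb₃⟩
    rw [hW] at hb₁ hb₂ hb₃
    have hμ : μ.eval z = 0 := by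
      by_contra hμ
      have g₁ := congrArg (eval z) hb₁
      have g₂ := congrArg (eval z) hb₂
      have g₃ := congrArg (eval z) hb₃
      simp [hμ] at g₁ g₂ g₃
      exact hne ⟨g₁, g₂, g₃⟩
    obtain ⟨ν, rfl⟩ := dvd_iff_isRoot.mpr hμ
    rw [mul_assoc] at hb₁ hb₂ hb₃
    obtain ⟨u₁, v₁, w₁⟩ := eval_derivatives_of_eq (mul_left_cancel₀ hX hb₁)
    obtain ⟨u₂, v₂, w₂⟩ := eval_derivatives_of_eq (mul_left_cancel₀ hX hb₂)
    obtain ⟨u₃, v₃, w₃⟩ := eval_derivatives_of_eq (mul_left_cancel₀ hX hb₃)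
    clear hb₁ hb₂ hb₃
    simp only [X_sub_C_sq_dvd_iff] at hb
    generalize eval z ν = n₀ at *
    generalize eval z (derivative ν) = n₁ at *
    generalize eval z (derivative (derivative ν)) = n₂ at *
    generalize eval z β = c₀ at *
    generalize eval z (derivative β) = c₁ at *
    generalize eval z (derivative (derivative β)) = c₂ at *
    refine ⟨![c₀ ^ 2 * n₂ - 4 * c₀ * c₁ * n₁ + (6 * c₁ ^ 2 - 2 * c₀ * c₂) * n₀,
      2 * c₀ ^ 2 * n₁ - 4 * c₀ * c₁ * n₀, c₀ ^ 2 * n₀], ?_, ?_⟩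
    · ext m
      fin_cases m <;> simp [Fin.sum_univ_three]
      · linear_combination (-c₀ ^ 2) * w₁ + 4 * c₀ * c₁ * v₁ + (2 * c₀ * c₂ - 6 * c₁ ^ 2) * u₁
      · linear_combination (-c₀ ^ 2) * w₂ + 4 * c₀ * c₁ * v₂ + (2 * c₀ * c₂ - 6 * c₁ ^ 2) * u₂
      · linear_combination (-c₀ ^ 2) * w₃ + 4 * c₀ * c₁ * v₃ + (2 * c₀ * c₂ - 6 * c₁ ^ 2) * u₃
    · by_contra! hg
      have hn₀ : n₀ = 0 := by simpa [hβ0] using hg 2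
      subst hn₀
      have hn₁ : n₁ = 0 := by simpa [hβ0] using hg 1
      subst hn₁
      simp [hβ0] at u₁ u₂ u₃
      simp [hβ0, u₁] at v₁
      simp [hβ0, u₂] at v₂
      simp [hβ0, u₃] at v₃
      exact hb ⟨⟨u₁, v₁⟩, ⟨u₂, v₂⟩, ⟨u₃, v₃⟩⟩
  · rintro ⟨g, hg, hg0⟩
    have k₁ := congrFun hg 0
    have k₂ := congrFun hg 1
    have k₃ := congrFun hg 2
    simp [Fin.sum_univ_three] at k₁ k₂ k₃
    set ν : Polynomial ℂ := Polynomial.C (g 2) + Polynomial.C (g 1 / 2) * (X - Polynomial.C z)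
      + Polynomial.C (g 0 / 2) * (X - Polynomial.C z) ^ 2 with hν
    have hν₀ : ν.eval z = g 2 := by simp [hν]
    have hν₁ : (derivative ν).eval z = g 1 / 2 := by simp [hν, derivative_pow]
    have hν₂ : (derivative (derivative ν)).eval z = g 0 := by
      simp [hν, derivative_pow]
    have hP (f : Polynomial ℂ) (k : g 0 * f.eval z + g 1 * (derivative f).eval z
        + g 2 * (derivative (derivative f)).eval z = 0) :
        (derivative (derivative (ν * f))).eval z = 0 := by
      simp only [derivative_mul, derivative_add, eval_add, eval_mul, hν₀, hν₁, hν₂]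
      linear_combination k
    obtain ⟨c₁, hc₁⟩ := exists_X_sub_C_mul_derivative_sub_eq z _ (hP f₁ k₁)
    obtain ⟨c₂, hc₂⟩ := exists_X_sub_C_mul_derivative_sub_eq z _ (hP f₂ k₂)
    obtain ⟨c₃, hc₃⟩ := exists_X_sub_C_mul_derivative_sub_eq z _ (hP f₃ k₃)
    have hS (c f : Polynomial ℂ) (hc : (X - Polynomial.C z) * derivative c - 2 * c = ν * f) :
        (X - Polynomial.C z) ^ 2 * β * derivative (β * c)
          - derivative ((X - Polynomial.C z) ^ 2 * β) * (β * c)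
          = (X - Polynomial.C z) * β ^ 2 * ν * f := by
      rw [hW, derivative_mul]
      linear_combination (X - Polynomial.C z) * β ^ 2 * hc
    refine ⟨(X - Polynomial.C z) * β ^ 2 * ν, β * c₁, β * c₂, β * c₃, ?_, hS _ _ hc₁, hS _ _ hc₂,
      hS _ _ hc₃⟩
    have hD (c f : Polynomial ℂ) (hc : (X - Polynomial.C z) * derivative c - 2 * c = ν * f)
        (hd : (X - Polynomial.C z) ^ 2 ∣ β * c) :
        g 2 * f.eval z = 0 ∧ g 1 / 2 * f.eval z + g 2 * (derivative f).eval z = 0 := by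
      obtain ⟨d₀, d₁⟩ := (X_sub_C_sq_dvd_iff z _).mp hd
      have e₀ : c.eval z = 0 := by simpa [hβ0] using d₀
      have e₁ : (derivative c).eval z = 0 := by simpa [hβ0, e₀] using d₁
      obtain ⟨u, v, -⟩ := eval_derivatives_of_eq (β := 1) (b := c) (ν := ν) (F := f)
        (by simpa using hc)
      simp [e₀, e₁, hν₀, hν₁] at u v
      exact ⟨by simpa using u, v.symm⟩
    rintro ⟨d₁, d₂, d₃⟩
    obtain ⟨u₁, v₁⟩ := hD _ _ hc₁ d₁
    obtain ⟨u₂, v₂⟩ := hD _ _ hc₂ d₂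
    obtain ⟨u₃, v₃⟩ := hD _ _ hc₃ d₃
    have g₂ : g 2 = 0 := by
      by_contra h
      exact hne ⟨(mul_eq_zero.mp u₁).resolve_left h, (mul_eq_zero.mp u₂).resolve_left h,
        (mul_eq_zero.mp u₃).resolve_left h⟩
    have g₁ : g 1 = 0 := by
      by_contra h
      simp [g₂, h] at v₁ v₂ v₃
      exact hne ⟨v₁, v₂, v₃⟩
    have g₀ : g 0 = 0 := by
      by_contra h
      simp [g₂, g₁, h] at k₁ k₂ k₃
      exact hne ⟨k₁, k₂, k₃⟩
    obtain ⟨m, hm⟩ := hg0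
    fin_cases m
    exacts [hm g₀, hm g₁, hm g₂]
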